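/- Let k₁, k₂ ≥ 4 be even integers, let ν ≥ 0 be an integer, and let z = (z₁,z₂) ∈ ℍ². The summand (γ,δ) ↦ N(c_{γδ⁻¹})^{ν}·j(γ,z)^{−(k₁+ν)·1}·j(δ,z)^{−(k₂+ν)·1} is well defined on pairs of cosets in (Γ∞⁺\Γ)², and the sum over all pairs (γ,δ) with σ₁(c_{γδ⁻¹}) ≠ 0 and σ₂(c_{γδ⁻¹}) ≠ 0 converges absolutely and equals 4 times the sum over the pairs (γ,δ) with c_{γδ⁻¹} totally positive: Σ_{(γ,δ): σ₁(c)≠0, σ₂(c)≠0} N(c)^{ν}·j(γ,z)^{−(k₁+ν)·1}·j(δ,z)^{−(k₂+ν)·1} = 4·Σ_{(γ,δ): c≫0} N(c)^{ν}·j(γ,z)^{−(k₁+ν)·1}·j(δ,z)^{−(k₂+ν)·1}, where c = c_{γδ⁻¹}. -/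

import Mathlib

open Complex

noncomputable section

namespace HilbertPaper

/-- Möbius action of a real 2×2 matrix on a complex number. -/
def moebius (g : Matrix (Fin 2) (Fin 2) ℝ) (z : ℂ) : ℂ :=
  (((g 0 0 : ℝ) : ℂ) * z + ((g 0 1 : ℝ) : ℂ)) / (((g 1 0 : ℝ) : ℂ) * z + ((g 1 1 : ℝ) : ℂ))

/-- Automorphy factor `j(g, z) = c z + d`. -/
def jfac (g : Matrix (Fin 2) (Fin 2) ℝ) (z : ℂ) : ℂ :=
  ((g 1 0 : ℝ) : ℂ) * z + ((g 1 1 : ℝ) : ℂ)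

variable (F : Type) [Field F] [NumberField F]

/-- The embedding of the ring of integers into ℝ induced by a real embedding σ of F. -/
def emb (σ : F →+* ℝ) : NumberField.RingOfIntegers F →+* ℝ :=
  σ.comp (algebraMap (NumberField.RingOfIntegers F) F)

/-- An element of F is totally positive when both real embeddings are positive on it. -/
def TotPos (σ₁ σ₂ : F →+* ℝ) (x : F) : Prop := 0 < σ₁ x ∧ 0 < σ₂ x

/-- `F` is a real quadratic field with narrow class number one, whose two real embeddings
are `σ₁ ≠ σ₂`; narrow class number one is expressed as: every nonzero ideal of the ring of
integers has a totally positive generator. -/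
def RealQuadNarrowOne (σ₁ σ₂ : F →+* ℝ) : Prop :=
  Module.finrank ℚ F = 2 ∧ σ₁ ≠ σ₂ ∧
    ∀ I : Ideal (NumberField.RingOfIntegers F), I ≠ ⊥ →
      ∃ a : NumberField.RingOfIntegers F,
        TotPos F σ₁ σ₂ (algebraMap (NumberField.RingOfIntegers F) F a) ∧ I = Ideal.span {a}

/-- Γ = SL₂(O). -/
abbrev SL2O := Matrix.SpecialLinearGroup (Fin 2) (NumberField.RingOfIntegers F)

/-- The real matrix obtained from γ ∈ SL₂(O) by applying σ entrywise. -/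
def mat (σ : F →+* ℝ) (γ : SL2O F) : Matrix (Fin 2) (Fin 2) ℝ :=
  (γ : Matrix (Fin 2) (Fin 2) (NumberField.RingOfIntegers F)).map (emb F σ)

/-- Membership in the subgroup A = {diag(ε, ε⁻¹) : ε a totally positive unit}. -/
def IsInA (σ₁ σ₂ : F →+* ℝ) (a : SL2O F) : Prop :=
  ∃ ε : (NumberField.RingOfIntegers F)ˣ,
    TotPos F σ₁ σ₂ (algebraMap (NumberField.RingOfIntegers F) F (ε : NumberField.RingOfIntegers F)) ∧
    (a : Matrix (Fin 2) (Fin 2) (NumberField.RingOfIntegers F)) =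
      !![(ε : NumberField.RingOfIntegers F), 0; 0, ((ε⁻¹ : (NumberField.RingOfIntegers F)ˣ) : NumberField.RingOfIntegers F)]

/-- The relation on Γ whose quotient is the coset space A\Γ. -/
def ARel (σ₁ σ₂ : F →+* ℝ) (γ γ' : SL2O F) : Prop :=
  ∃ a : SL2O F, IsInA F σ₁ σ₂ a ∧ γ' = a * γ

/-- The summand of the Cohen kernel: (γ₁z₁)^{-s} (γ₂z₂)^{-s} j(γ,z)^{-k·1}. -/
def cohenSummand (σ₁ σ₂ : F →+* ℝ) (k : ℕ) (s : ℂ) (z₁ z₂ : ℂ) (γ : SL2O F) : ℂ :=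
  moebius (mat F σ₁ γ) z₁ ^ (-s) * moebius (mat F σ₂ γ) z₂ ^ (-s) *
    (jfac (mat F σ₁ γ) z₁ ^ (-(k : ℤ)) * jfac (mat F σ₂ γ) z₂ ^ (-(k : ℤ)))


/-- Membership in Γ∞⁺, the upper-triangular elements of Γ with totally positive diagonal. -/
def IsInGammaInfPos (σ₁ σ₂ : F →+* ℝ) (p : SL2O F) : Prop :=
  (p : Matrix (Fin 2) (Fin 2) (NumberField.RingOfIntegers F)) 1 0 = 0 ∧
  TotPos F σ₁ σ₂ (algebraMap (NumberField.RingOfIntegers F) F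
    ((p : Matrix (Fin 2) (Fin 2) (NumberField.RingOfIntegers F)) 0 0)) ∧
  TotPos F σ₁ σ₂ (algebraMap (NumberField.RingOfIntegers F) F
    ((p : Matrix (Fin 2) (Fin 2) (NumberField.RingOfIntegers F)) 1 1))

/-- The relation on Γ whose quotient is the coset space Γ∞⁺\Γ. -/
def GammaInfRel (σ₁ σ₂ : F →+* ℝ) (γ γ' : SL2O F) : Prop :=
  ∃ p : SL2O F, IsInGammaInfPos F σ₁ σ₂ p ∧ γ' = p * γ

/-- The relation on Γ × Γ whose quotient is (Γ∞⁺\Γ)². -/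
def PairRel (σ₁ σ₂ : F →+* ℝ) (p q : SL2O F × SL2O F) : Prop :=
  GammaInfRel F σ₁ σ₂ p.1 q.1 ∧ GammaInfRel F σ₁ σ₂ p.2 q.2

/-- `c_{γδ⁻¹}`, the lower-left entry of γδ⁻¹. -/
def lowc (γ δ : SL2O F) : NumberField.RingOfIntegers F :=
  ((γ * δ⁻¹ : SL2O F) : Matrix (Fin 2) (Fin 2) (NumberField.RingOfIntegers F)) 1 0

/-- The summand of the double Eisenstein series E_{s, k-s}(z; w). -/
def dblSummand (σ₁ σ₂ : F →+* ℝ) (k : ℕ) (s w : ℂ) (z₁ z₂ : ℂ) (γ δ : SL2O F) : ℂ :=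
  ((σ₁ (algebraMap (NumberField.RingOfIntegers F) F (lowc F γ δ)) : ℝ) : ℂ) ^ (w - 1) *
  ((σ₂ (algebraMap (NumberField.RingOfIntegers F) F (lowc F γ δ)) : ℝ) : ℂ) ^ (w - 1) *
  ((jfac (mat F σ₁ γ) z₁ / jfac (mat F σ₁ δ) z₁) ^ (-s) *
   (jfac (mat F σ₂ γ) z₂ / jfac (mat F σ₂ δ) z₂) ^ (-s)) *
  (jfac (mat F σ₁ δ) z₁ ^ (-(k : ℤ)) * jfac (mat F σ₂ δ) z₂ ^ (-(k : ℤ)))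

open Classical in
/-- The summand of the double Eisenstein series, extended by zero to pairs whose
`c_{γδ⁻¹}` is not totally positive. -/
def dblExt (σ₁ σ₂ : F →+* ℝ) (k : ℕ) (s w : ℂ) (z₁ z₂ : ℂ) (γ δ : SL2O F) : ℂ :=
  if TotPos F σ₁ σ₂ (algebraMap (NumberField.RingOfIntegers F) F (lowc F γ δ)) then
    dblSummand F σ₁ σ₂ k s w z₁ z₂ γ δ
  else 0

/-- The summand `N(c_{γδ⁻¹})^ν · j(γ,z)^{-(k₁+ν)·1} · j(δ,z)^{-(k₂+ν)·1}`. -/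
def rcSummand (σ₁ σ₂ : F →+* ℝ) (k₁ k₂ ν : ℕ) (z₁ z₂ : ℂ) (γ δ : SL2O F) : ℂ :=
  ((σ₁ (algebraMap (NumberField.RingOfIntegers F) F (lowc F γ δ)) *
    σ₂ (algebraMap (NumberField.RingOfIntegers F) F (lowc F γ δ)) : ℝ) : ℂ) ^ ν *
  (jfac (mat F σ₁ γ) z₁ ^ (-((k₁ : ℤ) + ν)) * jfac (mat F σ₂ γ) z₂ ^ (-((k₁ : ℤ) + ν))) *
  (jfac (mat F σ₁ δ) z₁ ^ (-((k₂ : ℤ) + ν)) * jfac (mat F σ₂ δ) z₂ ^ (-((k₂ : ℤ) + ν)))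

open Classical in
/-- The summand above, extended by zero off the locus where `c_{γδ⁻¹}` is totally positive. -/
def rcExtPos (σ₁ σ₂ : F →+* ℝ) (k₁ k₂ ν : ℕ) (z₁ z₂ : ℂ) (γ δ : SL2O F) : ℂ :=
  if TotPos F σ₁ σ₂ (algebraMap (NumberField.RingOfIntegers F) F (lowc F γ δ)) then
    rcSummand F σ₁ σ₂ k₁ k₂ ν z₁ z₂ γ δ
  else 0

open Classical in
/-- The summand above, extended by zero off the locus where both embeddings of `c_{γδ⁻¹}`
are nonzero. -/
def rcExtNZ (σ₁ σ₂ : F →+* ℝ) (k₁ k₂ ν : ℕ) (z₁ z₂ : ℂ) (γ δ : SL2O F) : ℂ :=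
  if σ₁ (algebraMap (NumberField.RingOfIntegers F) F (lowc F γ δ)) ≠ 0 ∧
     σ₂ (algebraMap (NumberField.RingOfIntegers F) F (lowc F γ δ)) ≠ 0 then
    rcSummand F σ₁ σ₂ k₁ k₂ ν z₁ z₂ γ δ
  else 0

section NumberTheory

variable {F}
variable {σ₁ σ₂ : F →+* ℝ}

open NumberField

lemma complex_embedding_eq (h2 : Module.finrank ℚ F = 2) (hne : σ₁ ≠ σ₂) (φ : F →+* ℂ) :
    φ = ofRealHom.comp σ₁ ∨ φ = ofRealHom.comp σ₂ := by
  classical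
  by_contra! h
  have h12 : ofRealHom.comp σ₁ ≠ ofRealHom.comp σ₂ := fun e =>
    hne (RingHom.ext fun x => by simpa using RingHom.congr_fun e x)
  have hc : ({φ, ofRealHom.comp σ₁, ofRealHom.comp σ₂} : Finset (F →+* ℂ)).card = 3 :=
    Finset.card_eq_three.mpr ⟨_, _, _, h.1, h.2, h12, rfl⟩
  have := Finset.card_le_univ ({φ, ofRealHom.comp σ₁, ofRealHom.comp σ₂} : Finset (F →+* ℂ))
  rw [hc, Embeddings.card, h2] at this
  omega

lemma abs_emb_mul_emb_unit (h2 : Module.finrank ℚ F = 2) (hne : σ₁ ≠ σ₂) (u : (𝓞 F)ˣ) :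
    |emb F σ₁ u * emb F σ₂ u| = 1 := by
  classical
  have h12 : ofRealHom.comp σ₁ ≠ ofRealHom.comp σ₂ := fun e =>
    hne (RingHom.ext fun x => by simpa using RingHom.congr_fun e x)
  have hu : (Finset.univ : Finset (F →+* ℂ)) = {ofRealHom.comp σ₁, ofRealHom.comp σ₂} := by
    ext φ
    simpa using complex_embedding_eq h2 hne φ
  have hn := Algebra.norm_eq_prod_embeddings ℚ ℂ (algebraMap (𝓞 F) F u)
  rw [← Fintype.prod_equiv (RingHom.equivRatAlgHom F ℂ) (fun φ => φ (algebraMap (𝓞 F) F u))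
    _ (fun _ => by simp [RingHom.equivRatAlgHom_apply]), hu, Finset.prod_pair h12] at hn
  have h1 := NumberField.isUnit_iff_norm.mp u.isUnit
  rw [RingOfIntegers.coe_norm] at h1
  have h3 : ((Algebra.norm ℚ (algebraMap (𝓞 F) F u) : ℚ) : ℝ) = emb F σ₁ u * emb F σ₂ u := by
    have : (((Algebra.norm ℚ (algebraMap (𝓞 F) F u) : ℚ) : ℝ) : ℂ)
        = ((emb F σ₁ u * emb F σ₂ u : ℝ) : ℂ) := by
      simpa [emb] using hn
    exact_mod_cast this
  rw [← h3]
  exact_mod_cast h1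

lemma emb_injective {F : Type} [Field F] (σ : F →+* ℝ) : Function.Injective (emb F σ) :=
  σ.injective.comp RingOfIntegers.coe_injective

lemma exists_emb_ne (hne : σ₁ ≠ σ₂) : ∃ a : 𝓞 F, emb F σ₁ a ≠ emb F σ₂ a := by
  by_contra! h
  exact hne (IsLocalization.ringHom_ext (nonZeroDivisors (𝓞 F)) (RingHom.ext h))

lemma exists_unit_mixed_sign (hF : RealQuadNarrowOne F σ₁ σ₂) :
    ∃ u : (𝓞 F)ˣ, 0 < emb F σ₁ u ∧ emb F σ₂ u < 0 := by
  obtain ⟨h2, hne, hI⟩ := hF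
  obtain ⟨a, ha⟩ : ∃ a : 𝓞 F, emb F σ₂ a < emb F σ₁ a := by
    obtain ⟨a, ha⟩ := exists_emb_ne hne
    rcases ha.lt_or_gt with h | h
    · exact ⟨-a, by simpa using h⟩
    · exact ⟨a, h⟩
  obtain ⟨r, hr1, hr2⟩ := exists_rat_btwn ha
  have hd : (0 : ℝ) < r.den := by exact_mod_cast r.den_pos
  have hr : (r : ℝ) = r.num / r.den := by exact_mod_cast (Rat.num_div_den r).symm
  rw [hr] at hr1 hr2
  rw [lt_div_iff₀ hd] at hr1
  rw [div_lt_iff₀ hd] at hr2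
  let b : 𝓞 F := a * (r.den : 𝓞 F) - (r.num : 𝓞 F)
  have hb1 : 0 < emb F σ₁ b := by
    simp only [b, map_sub, map_mul, map_natCast, map_intCast]
    linarith
  have hb2 : emb F σ₂ b < 0 := by
    simp only [b, map_sub, map_mul, map_natCast, map_intCast]
    linarith
  have hb0 : b ≠ 0 := fun h => by simp [h] at hb1
  obtain ⟨t, ⟨ht1, ht2⟩, hbt⟩ := hI (Ideal.span {b}) (by simpa using hb0)
  obtain ⟨u, hu⟩ := Ideal.span_singleton_eq_span_singleton.mp hbt.symm
  refine ⟨u, ?_, ?_⟩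
  · have : emb F σ₁ t * emb F σ₁ u = emb F σ₁ b := by rw [← map_mul, hu]
    exact (pos_iff_pos_of_mul_pos (this ▸ hb1)).mp ht1
  · have : emb F σ₂ t * emb F σ₂ u = emb F σ₂ b := by rw [← map_mul, hu]
    have ht : 0 < emb F σ₂ t := ht2
    by_contra! h
    linarith [mul_nonneg ht.le h]

lemma exists_totPos_unit_ratio (h2 : Module.finrank ℚ F = 2) (hne : σ₁ ≠ σ₂) :
    ∃ u : (𝓞 F)ˣ, 0 < emb F σ₁ u ∧ 0 < emb F σ₂ u ∧
      1 < emb F σ₁ u / emb F σ₂ u := by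
  classical
  obtain ⟨u, hu⟩ := Units.dirichletUnitTheorem.exists_unit F
    (InfinitePlace.mk (ofRealHom.comp σ₁))
  have hw : InfinitePlace.mk (ofRealHom.comp σ₂) ≠ InfinitePlace.mk (ofRealHom.comp σ₁) := by
    intro h
    rw [InfinitePlace.mk_eq_iff] at h
    have : ComplexEmbedding.conjugate (ofRealHom.comp σ₂) = ofRealHom.comp σ₂ := by
      ext x; simp [ComplexEmbedding.conjugate_coe_eq]
    rw [this, or_self] at h
    exact hne (RingHom.ext fun x => by simpa using (RingHom.congr_fun h x).symm)
  have h1 : (InfinitePlace.mk (ofRealHom.comp σ₂)) (u : F) = |emb F σ₂ u| := by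
    rw [InfinitePlace.apply]
    simp [emb]
  have hlog := hu _ hw
  rw [h1] at hlog
  have hs2 : emb F σ₂ u ≠ 0 := by
    simpa using (emb_injective σ₂).ne u.ne_zero
  have hs1 : emb F σ₁ u ≠ 0 := by
    simpa using (emb_injective σ₁).ne u.ne_zero
  have hlt : |emb F σ₂ u| < 1 := by
    by_contra! h
    exact absurd hlog (not_lt.mpr (Real.log_nonneg h))
  have hN := abs_emb_mul_emb_unit h2 hne u
  rw [abs_mul] at hN
  have hgt : |emb F σ₂ u| < |emb F σ₁ u| := by
    have := abs_pos.mpr hs1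
    have := abs_pos.mpr hs2
    by_contra! h
    nlinarith
  refine ⟨u ^ 2, ?_, ?_, ?_⟩
  · simp only [Units.val_pow_eq_pow_val, map_pow]; positivity
  · simp only [Units.val_pow_eq_pow_val, map_pow]; positivity
  · simp only [Units.val_pow_eq_pow_val, map_pow]
    rw [one_lt_div (by positivity)]
    exact sq_lt_sq.mpr hgt

end NumberTheory

section Cosets

variable {F}
variable {σ₁ σ₂ : F →+* ℝ}

open NumberField

/-- The lower row of `γ'` is `u` times the lower row of `γ`. -/
def LowerRowScaled {F : Type} [Field F] (u : 𝓞 F) (γ γ' : SL2O F) : Prop :=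
  γ' 1 0 = u * γ 1 0 ∧ γ' 1 1 = u * γ 1 1

lemma lowc_eq {F : Type} [Field F] (γ δ : SL2O F) :
    lowc F γ δ = γ 1 1 * (-δ 1 0) + γ 1 0 * δ 1 1 := by
  simp [lowc, Matrix.mul_apply, Matrix.SpecialLinearGroup.coe_inv, Matrix.adjugate_fin_two,
    Fin.sum_univ_two, add_comm]

lemma lowc_lowerRowScaled {F : Type} [Field F] {u v : 𝓞 F} {γ γ' δ δ' : SL2O F}
    (hγ : LowerRowScaled u γ γ') (hδ : LowerRowScaled v δ δ') :
    lowc F γ' δ' = u * v * lowc F γ δ := by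
  simp only [lowc_eq, hγ.1, hγ.2, hδ.1, hδ.2]
  ring

lemma jfac_mat {F : Type} [Field F] (σ : F →+* ℝ) (γ : SL2O F) (z : ℂ) :
    jfac (mat F σ γ) z = (emb F σ (γ 1 0) : ℂ) * z + (emb F σ (γ 1 1) : ℂ) := rfl

lemma jfac_lowerRowScaled {F : Type} [Field F] (σ : F →+* ℝ) {u : 𝓞 F} {γ γ' : SL2O F}
    (h : LowerRowScaled u γ γ') (z : ℂ) :
    jfac (mat F σ γ') z = (emb F σ u : ℂ) * jfac (mat F σ γ) z := by
  simp only [jfac_mat, h.1, h.2, map_mul, ofReal_mul]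
  ring

lemma det_row {F : Type} [Field F] (γ : SL2O F) : γ 0 0 * γ 1 1 - γ 0 1 * γ 1 0 = 1 := by
  rw [← Matrix.det_fin_two, γ.det_coe]

lemma gammaInfRel_iff {F : Type} [Field F] {σ₁ σ₂ : F →+* ℝ} {γ γ' : SL2O F} :
    GammaInfRel F σ₁ σ₂ γ γ' ↔
    ∃ u : (𝓞 F)ˣ, 0 < emb F σ₁ u ∧ 0 < emb F σ₂ u ∧ LowerRowScaled (u : 𝓞 F) γ γ' := by
  constructor
  · rintro ⟨p, ⟨h10, -, h11⟩, rfl⟩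
    have hdet := det_row p
    rw [h10, mul_zero, sub_zero] at hdet
    exact ⟨⟨p 1 1, p 0 0, by rw [mul_comm, hdet], hdet⟩, h11.1, h11.2,
      by simp [Matrix.mul_apply, Fin.sum_univ_two, h10],
      by simp [Matrix.mul_apply, Fin.sum_univ_two, h10]⟩
  · rintro ⟨u, h1, h2, h⟩
    have h10 : (γ' * γ⁻¹) 1 0 = 0 := by
      have := lowc_eq γ' γ
      rw [lowc] at this
      rw [this, h.1, h.2]
      ring
    have h11 : (γ' * γ⁻¹) 1 1 = u := by
      have : (γ' * γ⁻¹) 1 1 = γ' 1 1 * γ 0 0 - γ' 1 0 * γ 0 1 := by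
        simp [Matrix.mul_apply, Matrix.SpecialLinearGroup.coe_inv, Matrix.adjugate_fin_two,
          Fin.sum_univ_two]
        ring
      rw [this, h.1, h.2]
      linear_combination (u : 𝓞 F) * det_row γ
    have h00 : (γ' * γ⁻¹) 0 0 * u = 1 := by
      have := det_row (γ' * γ⁻¹)
      rwa [h10, h11, mul_zero, sub_zero] at this
    refine ⟨γ' * γ⁻¹, ⟨h10, ⟨?_, ?_⟩, ?_, ?_⟩, by simp⟩
    · have : emb F σ₁ ((γ' * γ⁻¹) 0 0) * emb F σ₁ u = 1 := by rw [← map_mul, h00, map_one]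
      exact (pos_iff_pos_of_mul_pos (this ▸ one_pos)).mpr h1
    · have : emb F σ₂ ((γ' * γ⁻¹) 0 0) * emb F σ₂ u = 1 := by rw [← map_mul, h00, map_one]
      exact (pos_iff_pos_of_mul_pos (this ▸ one_pos)).mpr h2
    · rw [h11]; exact h1
    · rw [h11]; exact h2

lemma LowerRowScaled.refl {F : Type} [Field F] (γ : SL2O F) :
    LowerRowScaled ((1 : (𝓞 F)ˣ) : 𝓞 F) γ γ := by
  simp [LowerRowScaled]

/-- The matrix `diag(u⁻¹, u)`. -/
def diagUnit {F : Type} [Field F] (u : (𝓞 F)ˣ) : SL2O F :=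
  ⟨!![((u⁻¹ : (𝓞 F)ˣ) : 𝓞 F), 0; 0, (u : 𝓞 F)], by simp [Matrix.det_fin_two]⟩

lemma coe_diagUnit {F : Type} [Field F] (u : (𝓞 F)ˣ) :
    (diagUnit u : Matrix (Fin 2) (Fin 2) (𝓞 F)) =
      !![((u⁻¹ : (𝓞 F)ˣ) : 𝓞 F), 0; 0, (u : 𝓞 F)] := rfl

lemma lowerRowScaled_diagUnit_mul {F : Type} [Field F] (u : (𝓞 F)ˣ) (γ : SL2O F) :
    LowerRowScaled (u : 𝓞 F) γ (diagUnit u * γ) := by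
  simp [LowerRowScaled, coe_diagUnit, Matrix.mul_apply, Fin.sum_univ_two]

lemma diagUnit_inv_mul_diagUnit_mul {F : Type} [Field F] (u : (𝓞 F)ˣ) (γ : SL2O F) :
    diagUnit u⁻¹ * (diagUnit u * γ) = γ := by
  rw [← mul_assoc]
  convert one_mul γ
  ext i j
  fin_cases i <;> fin_cases j <;> simp [coe_diagUnit, Matrix.mul_apply, Fin.sum_univ_two]

lemma GammaInfRel.diagUnit_mul {F : Type} [Field F] {σ₁ σ₂ : F →+* ℝ} (u : (𝓞 F)ˣ)
    {γ γ' : SL2O F} (h : GammaInfRel F σ₁ σ₂ γ γ') :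
    GammaInfRel F σ₁ σ₂ (diagUnit u * γ) (diagUnit u * γ') := by
  obtain ⟨v, h1, h2, h⟩ := gammaInfRel_iff.mp h
  have hγ := lowerRowScaled_diagUnit_mul u γ
  have hγ' := lowerRowScaled_diagUnit_mul u γ'
  refine gammaInfRel_iff.mpr ⟨v, h1, h2, ?_, ?_⟩
  · rw [hγ'.1, hγ.1, h.1]; ring
  · rw [hγ'.2, hγ.2, h.2]; ring

/-- The bijection `(γ, δ) ↦ (diag(u⁻¹, u) γ, δ)` of pairs of cosets. -/
def twist (σ₁ σ₂ : F →+* ℝ) (u : (𝓞 F)ˣ) :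
    Quot (PairRel F σ₁ σ₂) ≃ Quot (PairRel F σ₁ σ₂) where
  toFun := Quot.map (fun p => (diagUnit u * p.1, p.2)) fun _ _ h => ⟨h.1.diagUnit_mul u, h.2⟩
  invFun := Quot.map (fun p => (diagUnit u⁻¹ * p.1, p.2)) fun _ _ h => ⟨h.1.diagUnit_mul _, h.2⟩
  left_inv := by
    rintro ⟨p⟩
    exact congrArg (Quot.mk _) (Prod.ext (diagUnit_inv_mul_diagUnit_mul u p.1) rfl)
  right_inv := by
    rintro ⟨p⟩
    refine congrArg (Quot.mk _) (Prod.ext ?_ rfl)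
    simpa using diagUnit_inv_mul_diagUnit_mul u⁻¹ p.1

lemma twist_mk {F : Type} [Field F] {σ₁ σ₂ : F →+* ℝ} (u : (𝓞 F)ˣ) (p : SL2O F × SL2O F) :
    twist σ₁ σ₂ u (Quot.mk _ p) = Quot.mk _ (diagUnit u * p.1, p.2) := rfl

end Cosets

section Summand

variable {F}
variable {σ₁ σ₂ : F →+* ℝ}

open NumberField

lemma unit_scaling_identity {N M : ℂ} (hN : N = 1 ∨ N = -1) (hM : M = 1 ∨ M = -1)
    {k₁ k₂ : ℕ} (hk₁ : Even k₁) (hk₂ : Even k₂) (ν : ℕ) :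
    (N * M) ^ ν * N ^ (-((k₁ : ℤ) + ν)) * M ^ (-((k₂ : ℤ) + ν)) = 1 := by
  have key : ∀ {x : ℂ}, x = 1 ∨ x = -1 → ∀ {k : ℕ}, Even k →
      x ^ ν * x ^ (-((k : ℤ) + ν)) = 1 := by
    intro x hx k hk
    have hx0 : x ≠ 0 := by rcases hx with rfl | rfl <;> simp
    rw [← zpow_natCast x ν, ← zpow_add₀ hx0, show (ν : ℤ) + -((k : ℤ) + ν) = -k by ring,
      zpow_neg, zpow_natCast]
    rcases hx with rfl | rfl <;> simp [hk.neg_one_pow]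
  rw [mul_pow]
  linear_combination (M ^ ν * M ^ (-((k₂ : ℤ) + ν))) * key hN hk₁ + key hM hk₂

lemma emb_mul_emb_unit_eq (hF : RealQuadNarrowOne F σ₁ σ₂) (u : (𝓞 F)ˣ) :
    (emb F σ₁ u : ℂ) * (emb F σ₂ u : ℂ) = 1 ∨ (emb F σ₁ u : ℂ) * (emb F σ₂ u : ℂ) = -1 := by
  have := eq_or_eq_neg_of_abs_eq (abs_emb_mul_emb_unit hF.1 hF.2.1 u)
  exact_mod_cast this

lemma emb_lowc_lowerRowScaled {F : Type} [Field F] (σ : F →+* ℝ) {u v : 𝓞 F} {γ γ' δ δ' : SL2O F}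
    (hγ : LowerRowScaled u γ γ') (hδ : LowerRowScaled v δ δ') :
    σ (algebraMap (𝓞 F) F (lowc F γ' δ')) =
      emb F σ u * emb F σ v * σ (algebraMap (𝓞 F) F (lowc F γ δ)) := by
  rw [lowc_lowerRowScaled hγ hδ]
  simp [emb]

lemma rcSummand_lowerRowScaled (hF : RealQuadNarrowOne F σ₁ σ₂) {k₁ k₂ : ℕ} (hk₁ : Even k₁)
    (hk₂ : Even k₂) (ν : ℕ) (z₁ z₂ : ℂ) {u v : (𝓞 F)ˣ} {γ γ' δ δ' : SL2O F}
    (hγ : LowerRowScaled (u : 𝓞 F) γ γ') (hδ : LowerRowScaled (v : 𝓞 F) δ δ') :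
    rcSummand F σ₁ σ₂ k₁ k₂ ν z₁ z₂ γ' δ' = rcSummand F σ₁ σ₂ k₁ k₂ ν z₁ z₂ γ δ := by
  have key := unit_scaling_identity (emb_mul_emb_unit_eq hF u) (emb_mul_emb_unit_eq hF v)
    hk₁ hk₂ ν
  simp only [rcSummand, emb_lowc_lowerRowScaled _ hγ hδ, jfac_lowerRowScaled _ hγ,
    jfac_lowerRowScaled _ hδ, mul_zpow, ofReal_mul, mul_pow] at key ⊢
  linear_combination (σ₁ (algebraMap (𝓞 F) F (lowc F γ δ)) : ℂ) ^ ν *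
    (σ₂ (algebraMap (𝓞 F) F (lowc F γ δ)) : ℂ) ^ ν *
    (jfac (mat F σ₁ γ) z₁ ^ (-((k₁ : ℤ) + ν)) * jfac (mat F σ₂ γ) z₂ ^ (-((k₁ : ℤ) + ν))) *
    (jfac (mat F σ₁ δ) z₁ ^ (-((k₂ : ℤ) + ν)) * jfac (mat F σ₂ δ) z₂ ^ (-((k₂ : ℤ) + ν))) * key

lemma rcExt_pairRel (hF : RealQuadNarrowOne F σ₁ σ₂) {k₁ k₂ : ℕ} (hk₁ : Even k₁)
    (hk₂ : Even k₂) (ν : ℕ) (z₁ z₂ : ℂ) {p q : SL2O F × SL2O F} (h : PairRel F σ₁ σ₂ p q) :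
    rcExtNZ F σ₁ σ₂ k₁ k₂ ν z₁ z₂ p.1 p.2 = rcExtNZ F σ₁ σ₂ k₁ k₂ ν z₁ z₂ q.1 q.2 ∧
      rcExtPos F σ₁ σ₂ k₁ k₂ ν z₁ z₂ p.1 p.2 = rcExtPos F σ₁ σ₂ k₁ k₂ ν z₁ z₂ q.1 q.2 := by
  obtain ⟨u, hu1, hu2, hγ⟩ := gammaInfRel_iff.mp h.1
  obtain ⟨v, hv1, hv2, hδ⟩ := gammaInfRel_iff.mp h.2
  have h1 := mul_pos hu1 hv1
  have h2 := mul_pos hu2 hv2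
  constructor
  · simp only [rcExtNZ, rcSummand_lowerRowScaled hF hk₁ hk₂ ν z₁ z₂ hγ hδ,
      emb_lowc_lowerRowScaled _ hγ hδ, ne_eq, mul_eq_zero, hu1.ne', hu2.ne', hv1.ne', hv2.ne',
      false_or]
  · simp only [rcExtPos, TotPos, rcSummand_lowerRowScaled hF hk₁ hk₂ ν z₁ z₂ hγ hδ,
      emb_lowc_lowerRowScaled _ hγ hδ, mul_pos_iff_of_pos_left h1, mul_pos_iff_of_pos_left h2]
    congr

open Classical in
lemma rcExtPos_diagUnit_mul (hF : RealQuadNarrowOne F σ₁ σ₂) {k₁ k₂ : ℕ} (hk₁ : Even k₁)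
    (hk₂ : Even k₂) (ν : ℕ) (z₁ z₂ : ℂ) (u : (𝓞 F)ˣ) (γ δ : SL2O F) :
    rcExtPos F σ₁ σ₂ k₁ k₂ ν z₁ z₂ (diagUnit u * γ) δ =
      if 0 < emb F σ₁ u * σ₁ (algebraMap (𝓞 F) F (lowc F γ δ)) ∧
        0 < emb F σ₂ u * σ₂ (algebraMap (𝓞 F) F (lowc F γ δ)) then
        rcSummand F σ₁ σ₂ k₁ k₂ ν z₁ z₂ γ δ else 0 := by
  have hγ := lowerRowScaled_diagUnit_mul u γ
  have hδ := LowerRowScaled.refl δ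
  simp only [rcExtPos, TotPos, rcSummand_lowerRowScaled hF hk₁ hk₂ ν z₁ z₂ hγ hδ,
      emb_lowc_lowerRowScaled _ hγ hδ, Units.val_one, map_one, mul_one]

lemma rcExtNZ_eq_add (hF : RealQuadNarrowOne F σ₁ σ₂) {k₁ k₂ : ℕ} (hk₁ : Even k₁)
    (hk₂ : Even k₂) (ν : ℕ) (z₁ z₂ : ℂ) {u : (𝓞 F)ˣ} (hu1 : 0 < emb F σ₁ u)
    (hu2 : emb F σ₂ u < 0) (γ δ : SL2O F) :
    rcExtNZ F σ₁ σ₂ k₁ k₂ ν z₁ z₂ γ δ =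
      rcExtPos F σ₁ σ₂ k₁ k₂ ν z₁ z₂ γ δ +
      rcExtPos F σ₁ σ₂ k₁ k₂ ν z₁ z₂ (diagUnit (-1) * γ) δ +
      rcExtPos F σ₁ σ₂ k₁ k₂ ν z₁ z₂ (diagUnit u * γ) δ +
      rcExtPos F σ₁ σ₂ k₁ k₂ ν z₁ z₂ (diagUnit (-u) * γ) δ := by
  simp only [rcExtPos_diagUnit_mul hF hk₁ hk₂, rcExtNZ]
  rw [rcExtPos, TotPos]
  generalize σ₁ (algebraMap (𝓞 F) F (lowc F γ δ)) = a
  generalize σ₂ (algebraMap (𝓞 F) F (lowc F γ δ)) = b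
  generalize rcSummand F σ₁ σ₂ k₁ k₂ ν z₁ z₂ γ δ = S
  have h_neg : ∀ {c x : ℝ}, c < 0 → (0 < c * x ↔ x < 0) := fun {c x} hc => by
    rw [← neg_mul_neg, mul_pos_iff_of_pos_left (neg_pos.mpr hc), neg_pos]
  have e1 : ∀ x : ℝ, 0 < emb F σ₂ u * x ↔ x < 0 := fun x => h_neg hu2
  have e2 : ∀ x : ℝ, 0 < -emb F σ₁ u * x ↔ x < 0 := fun x => h_neg (neg_neg_of_pos hu1)
  have e3 : ∀ x : ℝ, 0 < -emb F σ₂ u * x ↔ 0 < x := fun x =>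
    mul_pos_iff_of_pos_left (neg_pos.mpr hu2)
  simp only [Units.val_neg, Units.val_one, map_neg, map_one, e1, e2, e3,
    mul_pos_iff_of_pos_left hu1, neg_one_mul, neg_pos]
  rcases lt_trichotomy a 0 with ha | rfl | ha <;> rcases lt_trichotomy b 0 with hb | rfl | hb <;>
    simp [*, ne_of_lt, ne_of_gt, not_lt_of_gt]

end Summand

section Convergence

variable {F}
variable {σ₁ σ₂ : F →+* ℝ}

open NumberField

/-- The map `(c, d) ↦ (σ₁(c)z₁ + σ₁(d), σ₂(c)z₂ + σ₂(d))`. -/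
def rowVec {F : Type} [Field F] (σ₁ σ₂ : F →+* ℝ) (z₁ z₂ : ℂ) : 𝓞 F × 𝓞 F →ₗ[ℤ] ℂ × ℂ :=
  AddMonoidHom.toIntLinearMap
    { toFun := fun x => ((emb F σ₁ x.1 : ℂ) * z₁ + (emb F σ₁ x.2 : ℂ),
        (emb F σ₂ x.1 : ℂ) * z₂ + (emb F σ₂ x.2 : ℂ))
      map_zero' := by simp
      map_add' := fun x y => by
        ext <;> simp only [Prod.fst_add, Prod.snd_add, map_add, ofReal_add] <;> ring }

lemma rowVec_apply {F : Type} [Field F] (σ₁ σ₂ : F →+* ℝ) (z₁ z₂ : ℂ) (x : 𝓞 F × 𝓞 F) :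
    rowVec σ₁ σ₂ z₁ z₂ x = ((emb F σ₁ x.1 : ℂ) * z₁ + (emb F σ₁ x.2 : ℂ),
      (emb F σ₂ x.1 : ℂ) * z₂ + (emb F σ₂ x.2 : ℂ)) := rfl

lemma abs_le_div_im {z : ℂ} (hz : 0 < z.im) (a b : ℝ) : |a| ≤ ‖(a : ℂ) * z + b‖ / z.im := by
  rw [le_div_iff₀ hz]
  nth_rewrite 1 [← abs_of_pos hz]
  rw [← abs_mul]
  simpa using abs_im_le_norm ((a : ℂ) * z + b)

lemma abs_le_norm_mul {z : ℂ} (hz : 0 < z.im) (a b : ℝ) :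
    |b| ≤ ‖(a : ℂ) * z + b‖ * (1 + ‖z‖ / z.im) := by
  have h1 := abs_le_div_im hz a b
  have h2 : |b| ≤ ‖(a : ℂ) * z + b‖ + |a| * ‖z‖ := by
    have := norm_sub_le ((a : ℂ) * z + b) (a * z)
    simpa using this
  calc |b| ≤ ‖(a : ℂ) * z + b‖ + ‖(a : ℂ) * z + b‖ / z.im * ‖z‖ := h2.trans (by gcongr)
    _ = _ := by ring

lemma finite_abs_emb_le (h2 : Module.finrank ℚ F = 2) (hne : σ₁ ≠ σ₂) (B : ℝ) :
    {a : 𝓞 F | |emb F σ₁ a| ≤ B ∧ |emb F σ₂ a| ≤ B}.Finite := by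
  refine ((Embeddings.finite_of_norm_le F ℂ B).preimage
    RingOfIntegers.coe_injective.injOn).subset fun a ha => ⟨a.isIntegral_coe, fun φ => ?_⟩
  rcases complex_embedding_eq h2 hne φ with rfl | rfl
  · simpa [emb] using ha.1
  · simpa [emb] using ha.2

variable {z₁ z₂ : ℂ}

lemma finite_norm_rowVec_le (h2 : Module.finrank ℚ F = 2) (hne : σ₁ ≠ σ₂)
    (hz₁ : 0 < z₁.im) (hz₂ : 0 < z₂.im) (R : ℝ) :
    {x : 𝓞 F × 𝓞 F | ‖rowVec σ₁ σ₂ z₁ z₂ x‖ ≤ R}.Finite := by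
  have hc := finite_abs_emb_le h2 hne (max (R / z₁.im) (R / z₂.im))
  have hd := finite_abs_emb_le h2 hne
    (max (R * (1 + ‖z₁‖ / z₁.im)) (R * (1 + ‖z₂‖ / z₂.im)))
  refine (hc.prod hd).subset fun x hx => ?_
  rw [Set.mem_ofPred_eq, rowVec_apply, Prod.norm_def, max_le_iff] at hx
  obtain ⟨h1, h2⟩ := hx
  refine ⟨⟨?_, ?_⟩, ?_, ?_⟩
  · exact (abs_le_div_im hz₁ _ _).trans (le_max_of_le_left (by gcongr))
  · exact (abs_le_div_im hz₂ _ _).trans (le_max_of_le_right (by gcongr))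
  · exact (abs_le_norm_mul hz₁ _ _).trans (le_max_of_le_left (by gcongr))
  · exact (abs_le_norm_mul hz₂ _ _).trans (le_max_of_le_right (by gcongr))

lemma rowVec_injective {F : Type} [Field F] (σ₁ σ₂ : F →+* ℝ) (hz₁ : 0 < z₁.im) :
    Function.Injective (rowVec σ₁ σ₂ z₁ z₂) := by
  refine (injective_iff_map_eq_zero _).mpr fun x hx => ?_
  rw [rowVec_apply, Prod.mk_eq_zero] at hx
  have h1 := abs_le_div_im hz₁ (emb F σ₁ x.1) (emb F σ₁ x.2)
  have h2 := abs_le_norm_mul hz₁ (emb F σ₁ x.1) (emb F σ₁ x.2)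
  rw [hx.1, norm_zero, zero_div, abs_nonpos_iff] at h1
  rw [hx.1, norm_zero, zero_mul, abs_nonpos_iff] at h2
  exact Prod.ext ((map_eq_zero_iff _ (emb_injective σ₁)).mp h1)
    ((map_eq_zero_iff _ (emb_injective σ₁)).mp h2)

lemma discreteTopology_range_rowVec (h2 : Module.finrank ℚ F = 2) (hne : σ₁ ≠ σ₂)
    (hz₁ : 0 < z₁.im) (hz₂ : 0 < z₂.im) :
    DiscreteTopology (LinearMap.range (rowVec σ₁ σ₂ z₁ z₂)) := by
  have hfin : (Metric.ball (0 : LinearMap.range (rowVec σ₁ σ₂ z₁ z₂)) 1 \ {0}).Finite := by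
    refine (((finite_norm_rowVec_le h2 hne hz₁ hz₂ 1).image
      (rowVec σ₁ σ₂ z₁ z₂).rangeRestrict).subset ?_)
    rintro ⟨_, x, rfl⟩ ⟨hx, -⟩
    refine ⟨x, ?_, rfl⟩
    rw [mem_ball_zero_iff] at hx
    exact hx.le
  refine discreteTopology_iff_isOpen_singleton_zero.mpr ?_
  have h0 := (Metric.isOpen_ball (x := 0) (ε := 1)).sdiff hfin.isClosed
  rwa [Set.sdiff_sdiff_right_self, Set.inter_eq_right.mpr (by simp)] at h0

lemma summable_norm_rowVec (h2 : Module.finrank ℚ F = 2) (hne : σ₁ ≠ σ₂)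
    (hz₁ : 0 < z₁.im) (hz₂ : 0 < z₂.im) {n : ℕ} (hn : 4 < n) :
    Summable fun x : 𝓞 F × 𝓞 F => ‖rowVec σ₁ σ₂ z₁ z₂ x‖⁻¹ ^ n := by
  have := discreteTopology_range_rowVec h2 hne hz₁ hz₂
  have hr : Module.finrank ℤ (LinearMap.range (rowVec σ₁ σ₂ z₁ z₂)) < n := by
    refine lt_of_le_of_lt (LinearMap.finrank_range_le _) ?_
    rw [Module.finrank_prod, RingOfIntegers.rank, h2]
    exact hn
  exact (ZLattice.summable_norm_pow_inv _ n hr).comp_injective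
    (i := (rowVec σ₁ σ₂ z₁ z₂).rangeRestrict)
    fun x y hxy => rowVec_injective σ₁ σ₂ hz₁ (congrArg Subtype.val hxy)

/-- The lower row of a matrix. -/
def lowerRow {F : Type} [Field F] (γ : SL2O F) : 𝓞 F × 𝓞 F := (γ 1 0, γ 1 1)

lemma rowVec_lowerRow {F : Type} [Field F] (σ₁ σ₂ : F →+* ℝ) (z₁ z₂ : ℂ) (γ : SL2O F) :
    rowVec σ₁ σ₂ z₁ z₂ (lowerRow γ) = (jfac (mat F σ₁ γ) z₁, jfac (mat F σ₂ γ) z₂) := rfl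

lemma gammaInfRel_of_lowerRow_eq {F : Type} [Field F] {σ₁ σ₂ : F →+* ℝ} {γ γ' : SL2O F}
    (h : lowerRow γ = lowerRow γ') : GammaInfRel F σ₁ σ₂ γ γ' := by
  rw [lowerRow, lowerRow, Prod.mk.injEq] at h
  exact gammaInfRel_iff.mpr ⟨1, by simp, by simp, by simp [LowerRowScaled, h]⟩

lemma jfac_ne_zero {F : Type} [Field F] (σ : F →+* ℝ) (γ : SL2O F) {z : ℂ} (hz : 0 < z.im) :
    jfac (mat F σ γ) z ≠ 0 := by
  intro h
  rw [jfac_mat] at h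
  have h1 := abs_le_div_im hz (emb F σ (γ 1 0)) (emb F σ (γ 1 1))
  have h2 := abs_le_norm_mul hz (emb F σ (γ 1 0)) (emb F σ (γ 1 1))
  rw [h, norm_zero, zero_div, abs_nonpos_iff, map_eq_zero_iff _ (emb_injective σ)] at h1
  rw [h, norm_zero, zero_mul, abs_nonpos_iff, map_eq_zero_iff _ (emb_injective σ)] at h2
  have := det_row γ
  simp [h1, h2] at this

lemma exists_balanced (h2 : Module.finrank ℚ F = 2) (hne : σ₁ ≠ σ₂)
    (hz₁ : 0 < z₁.im) (hz₂ : 0 < z₂.im) :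
    ∃ t : ℝ, ∀ γ : SL2O F, ∃ γ' : SL2O F, GammaInfRel F σ₁ σ₂ γ γ' ∧
      ‖rowVec σ₁ σ₂ z₁ z₂ (lowerRow γ')‖ ^ 2 ≤
        t * (‖jfac (mat F σ₁ γ') z₁‖ * ‖jfac (mat F σ₂ γ') z₂‖) := by
  obtain ⟨u, hu1, hu2, hu⟩ := exists_totPos_unit_ratio h2 hne
  refine ⟨emb F σ₁ u / emb F σ₂ u, fun γ => ?_⟩
  have hj1 := norm_pos_iff.mpr (jfac_ne_zero σ₁ γ hz₁)
  have hj2 := norm_pos_iff.mpr (jfac_ne_zero σ₂ γ hz₂)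
  obtain ⟨n, hn1, hn2⟩ := exists_mem_Ico_zpow (div_pos hj1 hj2) hu
  have hz : ∀ σ : F →+* ℝ, emb F σ ((u ^ (-n) : (𝓞 F)ˣ) : 𝓞 F) = (emb F σ u) ^ (-n) := by
    intro σ
    have := congrArg Units.val (map_zpow (Units.map (emb F σ : 𝓞 F →* ℝ)) u (-n))
    rwa [Units.val_zpow_eq_zpow_val] at this
  have hγ := lowerRowScaled_diagUnit_mul (u ^ (-n)) γ
  refine ⟨diagUnit (u ^ (-n)) * γ, gammaInfRel_iff.mpr ⟨u ^ (-n), ?_, ?_, hγ⟩, ?_⟩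
  · rw [hz]; positivity
  · rw [hz]; positivity
  rw [rowVec_lowerRow, Prod.norm_def]
  simp only [jfac_lowerRowScaled _ hγ, norm_mul, hz, norm_real, norm_zpow,
    Real.norm_of_nonneg hu1.le, Real.norm_of_nonneg hu2.le]
  set a := emb F σ₁ u
  set b := emb F σ₂ u
  set x := ‖jfac (mat F σ₁ γ) z₁‖
  set y := ‖jfac (mat F σ₂ γ) z₂‖
  have hle : b ^ (-n) * y ≤ a ^ (-n) * x := by
    rw [le_div_iff₀ hj2, div_zpow, div_mul_eq_mul_div, div_le_iff₀ (by positivity)] at hn1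
    rw [zpow_neg, zpow_neg, inv_mul_le_iff₀ (by positivity), mul_left_comm,
      le_inv_mul_iff₀ (by positivity)]
    linarith
  have hlt : a ^ (-n) * x ≤ a / b * (b ^ (-n) * y) := by
    rw [zpow_add_one₀ (by positivity), div_lt_iff₀ hj2, div_zpow, mul_assoc, div_mul_eq_mul_div,
      lt_div_iff₀ (by positivity)] at hn2
    rw [zpow_neg, zpow_neg, inv_mul_le_iff₀ (by positivity),
      show a ^ n * (a / b * ((b ^ n)⁻¹ * y)) = (b ^ n)⁻¹ * (a ^ n * (a / b * y)) by ring,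
      le_inv_mul_iff₀ (by positivity)]
    linarith
  simp only [max_eq_left hle]
  calc (a ^ (-n) * x) ^ 2 = (a ^ (-n) * x) * (a ^ (-n) * x) := sq _
    _ ≤ (a ^ (-n) * x) * (a / b * (b ^ (-n) * y)) := by gcongr
    _ = _ := by ring

lemma abs_emb_lowc_le {F : Type} [Field F] (σ : F →+* ℝ) (γ δ : SL2O F) {z : ℂ}
    (hz : 0 < z.im) :
    |σ (algebraMap (𝓞 F) F (lowc F γ δ))| ≤
      z.im⁻¹ * (‖jfac (mat F σ γ) z‖ * ‖jfac (mat F σ δ) z‖) := by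
  rw [le_inv_mul_iff₀ hz, ← norm_conj (jfac (mat F σ δ) z), ← norm_mul]
  refine le_trans (le_of_eq ?_) (abs_im_le_norm _)
  nth_rewrite 1 [← abs_of_pos hz]
  rw [← abs_mul]
  congr 1
  change _ * emb F σ (lowc F γ δ) = _
  simp only [lowc_eq, jfac_mat, map_add, map_mul, map_neg, conj_ofReal]
  simp
  ring

lemma norm_rcSummand_le {F : Type} [Field F] (σ₁ σ₂ : F →+* ℝ) (k₁ k₂ ν : ℕ)
    (hz₁ : 0 < z₁.im) (hz₂ : 0 < z₂.im) (γ δ : SL2O F) :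
    ‖rcSummand F σ₁ σ₂ k₁ k₂ ν z₁ z₂ γ δ‖ ≤ (z₁.im⁻¹ * z₂.im⁻¹) ^ ν *
      ((‖jfac (mat F σ₁ γ) z₁‖ * ‖jfac (mat F σ₂ γ) z₂‖)⁻¹ ^ k₁ *
        (‖jfac (mat F σ₁ δ) z₁‖ * ‖jfac (mat F σ₂ δ) z₂‖)⁻¹ ^ k₂) := by
  have a1 := norm_pos_iff.mpr (jfac_ne_zero σ₁ γ hz₁)
  have a2 := norm_pos_iff.mpr (jfac_ne_zero σ₂ γ hz₂)
  have b1 := norm_pos_iff.mpr (jfac_ne_zero σ₁ δ hz₁)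
  have b2 := norm_pos_iff.mpr (jfac_ne_zero σ₂ δ hz₂)
  have c1 := abs_emb_lowc_le σ₁ γ δ hz₁
  have c2 := abs_emb_lowc_le σ₂ γ δ hz₂
  simp only [rcSummand, norm_mul, norm_pow, norm_zpow, norm_real, Real.norm_eq_abs]
  generalize ‖jfac (mat F σ₁ γ) z₁‖ = A₁ at *
  generalize ‖jfac (mat F σ₂ γ) z₂‖ = A₂ at *
  generalize ‖jfac (mat F σ₁ δ) z₁‖ = B₁ at *
  generalize ‖jfac (mat F σ₂ δ) z₂‖ = B₂ at *
  have hz : ∀ (x : ℝ) (k : ℕ), x ^ (-((k : ℤ) + ν)) = x⁻¹ ^ k * x⁻¹ ^ ν := by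
    intro x k
    rw [← pow_add, inv_pow, ← zpow_natCast, zpow_neg]
    push_cast
    rfl
  simp only [hz]
  refine (mul_le_mul_of_nonneg_right (mul_le_mul_of_nonneg_right (pow_le_pow_left₀ (by positivity)
    (mul_le_mul c1 c2 (by positivity) (by positivity)) ν) (by positivity))
    (by positivity)).trans (le_of_eq ?_)
  simp only [mul_pow, mul_inv, inv_pow]
  field_simp

lemma inv_pow_le_of_sq_le {t s x : ℝ} (hs : 0 < s) (h : s ^ 2 ≤ t * x) (hx : 0 < x) {k : ℕ} :
    x⁻¹ ^ k ≤ t ^ k * s⁻¹ ^ (2 * k) := by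
  rw [pow_mul, ← mul_pow]
  refine pow_le_pow_left₀ (by positivity) ?_ k
  rw [inv_pow, ← div_eq_mul_inv, le_div_iff₀ (by positivity), inv_mul_le_iff₀ hx]
  linarith

/-- A function on pairs of cosets whose values are bounded by the summand is summable. -/
lemma summable_of_norm_le_rcSummand (h2 : Module.finrank ℚ F = 2) (hne : σ₁ ≠ σ₂)
    {k₁ k₂ : ℕ} (hk₁ : 4 ≤ k₁) (hk₂ : 4 ≤ k₂) (ν : ℕ) (hz₁ : 0 < z₁.im) (hz₂ : 0 < z₂.im)
    {f : Quot (PairRel F σ₁ σ₂) → ℂ}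
    (hf : ∀ p, ‖f (Quot.mk _ p)‖ ≤ ‖rcSummand F σ₁ σ₂ k₁ k₂ ν z₁ z₂ p.1 p.2‖) :
    Summable f := by
  obtain ⟨t, ht⟩ := exists_balanced h2 hne hz₁ hz₂
  have hrep : ∀ q : Quot (PairRel F σ₁ σ₂), ∃ p : SL2O F × SL2O F, Quot.mk _ p = q ∧
      ‖rowVec σ₁ σ₂ z₁ z₂ (lowerRow p.1)‖ ^ 2 ≤
        t * (‖jfac (mat F σ₁ p.1) z₁‖ * ‖jfac (mat F σ₂ p.1) z₂‖) ∧
      ‖rowVec σ₁ σ₂ z₁ z₂ (lowerRow p.2)‖ ^ 2 ≤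
        t * (‖jfac (mat F σ₁ p.2) z₁‖ * ‖jfac (mat F σ₂ p.2) z₂‖) := by
    rintro ⟨γ, δ⟩
    obtain ⟨γ', hγ, hγ'⟩ := ht γ
    obtain ⟨δ', hδ, hδ'⟩ := ht δ
    exact ⟨(γ', δ'), (Quot.sound ⟨hγ, hδ⟩).symm, hγ', hδ'⟩
  choose r hr hr1 hr2 using hrep
  have hinj : Function.Injective fun q => (lowerRow (r q).1, lowerRow (r q).2) := by
    intro q q' h
    rw [Prod.mk.injEq] at h
    rw [← hr q, ← hr q']
    exact Quot.sound ⟨gammaInfRel_of_lowerRow_eq h.1, gammaInfRel_of_lowerRow_eq h.2⟩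
  have hs := ((((summable_norm_rowVec h2 hne hz₁ hz₂ (n := 2 * k₁) (by omega)).mul_of_nonneg
    (summable_norm_rowVec h2 hne hz₁ hz₂ (n := 2 * k₂) (by omega))
    (fun _ => by positivity) (fun _ => by positivity)).comp_injective hinj).mul_left
    (t ^ k₁ * t ^ k₂)).mul_left ((z₁.im⁻¹ * z₂.im⁻¹) ^ ν)
  refine hs.of_norm_bounded fun q => ?_
  have hpos : ∀ γ : SL2O F, 0 < ‖jfac (mat F σ₁ γ) z₁‖ * ‖jfac (mat F σ₂ γ) z₂‖ := fun γ =>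
    mul_pos (norm_pos_iff.mpr (jfac_ne_zero σ₁ γ hz₁)) (norm_pos_iff.mpr (jfac_ne_zero σ₂ γ hz₂))
  have hvec : ∀ γ : SL2O F, 0 < ‖rowVec σ₁ σ₂ z₁ z₂ (lowerRow γ)‖ := fun γ =>
    norm_pos_iff.mpr fun h => jfac_ne_zero σ₁ γ hz₁ (congrArg Prod.fst h)
  have h1 := inv_pow_le_of_sq_le (hvec _) (hr1 q) (hpos _) (k := k₁)
  have h2 := inv_pow_le_of_sq_le (hvec _) (hr2 q) (hpos _) (k := k₂)
  have hb := (hf (r q)).trans (norm_rcSummand_le σ₁ σ₂ k₁ k₂ ν hz₁ hz₂ (r q).1 (r q).2)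
  rw [hr q] at hb
  refine hb.trans (mul_le_mul_of_nonneg_left ?_ (by positivity))
  refine (mul_le_mul h1 h2 (pow_nonneg (inv_nonneg.mpr (hpos _).le) _)
    ((pow_nonneg (inv_nonneg.mpr (hpos _).le) _).trans h1)).trans (le_of_eq ?_)
  simp only [Function.comp_apply]
  ring

end Convergence

/-- For even `k₁, k₂ ≥ 4`, `ν ≥ 0` and `z ∈ ℍ²`, the summand
`N(c_{γδ⁻¹})^ν j(γ,z)^{-(k₁+ν)·1} j(δ,z)^{-(k₂+ν)·1}` is well defined on pairs of cosets in
`(Γ∞⁺\Γ)²`; the sum over pairs with `σ₁(c) ≠ 0` and `σ₂(c) ≠ 0` converges absolutely and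
equals `4` times the sum over pairs with `c` totally positive. -/
theorem statement14 (σ₁ σ₂ : F →+* ℝ) (hF : RealQuadNarrowOne F σ₁ σ₂)
    (k₁ k₂ : ℕ) (hk₁ : Even k₁) (hk₁4 : 4 ≤ k₁) (hk₂ : Even k₂) (hk₂4 : 4 ≤ k₂) (ν : ℕ)
    (z₁ z₂ : ℂ) (hz₁ : 0 < z₁.im) (hz₂ : 0 < z₂.im) :
    (∀ p q : SL2O F × SL2O F, PairRel F σ₁ σ₂ p q →
        rcExtNZ F σ₁ σ₂ k₁ k₂ ν z₁ z₂ p.1 p.2 = rcExtNZ F σ₁ σ₂ k₁ k₂ ν z₁ z₂ q.1 q.2 ∧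
        rcExtPos F σ₁ σ₂ k₁ k₂ ν z₁ z₂ p.1 p.2 = rcExtPos F σ₁ σ₂ k₁ k₂ ν z₁ z₂ q.1 q.2) ∧
    ∀ (f : Quot (PairRel F σ₁ σ₂) → ℂ),
      (∀ p : SL2O F × SL2O F, f (Quot.mk _ p) = rcExtNZ F σ₁ σ₂ k₁ k₂ ν z₁ z₂ p.1 p.2) →
      ∀ (g : Quot (PairRel F σ₁ σ₂) → ℂ),
        (∀ p : SL2O F × SL2O F, g (Quot.mk _ p) = rcExtPos F σ₁ σ₂ k₁ k₂ ν z₁ z₂ p.1 p.2) →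
        Summable f ∧ Summable g ∧ (∑' q, f q) = 4 * ∑' q, g q := by
  refine ⟨fun p q h => rcExt_pairRel hF hk₁ hk₂ ν z₁ z₂ h, fun f hf g hg => ?_⟩
  have hsf : Summable f := summable_of_norm_le_rcSummand hF.1 hF.2.1 hk₁4 hk₂4 ν hz₁ hz₂
    fun p => by
    rw [hf, rcExtNZ]
    split_ifs <;> simp
  have hsg : Summable g := summable_of_norm_le_rcSummand hF.1 hF.2.1 hk₁4 hk₂4 ν hz₁ hz₂
    fun p => by
    rw [hg, rcExtPos]
    split_ifs <;> simp
  refine ⟨hsf, hsg, ?_⟩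
  obtain ⟨u, hu1, hu2⟩ := exists_unit_mixed_sign hF
  have hfg : f = fun q => g q + g (twist σ₁ σ₂ (-1) q) + g (twist σ₁ σ₂ u q) +
      g (twist σ₁ σ₂ (-u) q) := by
    ext ⟨p⟩
    simp only [twist_mk, hf, hg]
    exact rcExtNZ_eq_add hF hk₁ hk₂ ν z₁ z₂ hu1 hu2 p.1 p.2
  have hst : ∀ v, Summable fun q => g (twist σ₁ σ₂ v q) := fun v =>
    (twist σ₁ σ₂ v).summable_iff.mpr hsg
  have htt : ∀ v, ∑' q, g (twist σ₁ σ₂ v q) = ∑' q, g q := fun v =>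
    (twist σ₁ σ₂ v).tsum_eq g
  rw [hfg, ((hsg.add (hst _)).add (hst _)).tsum_add (hst _), (hsg.add (hst _)).tsum_add (hst _),
    hsg.tsum_add (hst _), htt, htt, htt]
  ring

end HilbertPaper
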